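/- Let Σ ∈ ℂ^{L×L} be Hermitian positive definite, S ∈ ℂ^{L×L} Hermitian positive semidefinite, a ∈ ℂ^L, and d ∈ ℝ. Set c = a^H Σ^{-1} a and b = a^H Σ^{-1} S Σ^{-1} a (both real, c ≥ 0, b ≥ 0), and assume 1 + d·c > 0. Then Σ + d·a a^H is invertible and log det(Σ + d·a a^H) + Tr((Σ + d·a a^H)^{-1} S) = log det Σ + Tr(Σ^{-1} S) + log(1 + d·c) − b·d/(1 + d·c), where both determinants are positive reals and both traces are real. -/

import Mathlib

open Matrix ComplexOrder

/-- **Matrix determinant lemma**, for a scaled rank-one update. -/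
theorem det_add_smul_vecMulVec {n R : Type*} [Fintype n] [DecidableEq n] [CommRing R]
    {A : Matrix n n R} (hA : IsUnit A.det) (r : R) (u v : n → R) :
    (A + r • vecMulVec u v).det = A.det * (1 + r * (v ⬝ᵥ (A⁻¹ *ᵥ u))) := by
  have h : A + r • vecMulVec u v = A * (1 + vecMulVec (A⁻¹ *ᵥ (r • u)) v) := by
    rw [mul_add, mul_one, mul_vecMulVec, mulVec_mulVec, mul_nonsing_inv A hA, one_mulVec,
      smul_vecMulVec]
  rw [h, det_mul, vecMulVec_eq Unit, det_one_add_replicateCol_mul_replicateRow, mulVec_smul,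
    dotProduct_smul, smul_eq_mul]

/-- **Sherman–Morrison formula**, for a scaled rank-one update. -/
theorem inv_add_smul_vecMulVec {n K : Type*} [Fintype n] [DecidableEq n] [Field K]
    {A : Matrix n n K} (hA : IsUnit A.det) (r : K) (u v : n → K)
    (h : 1 + r * (v ⬝ᵥ (A⁻¹ *ᵥ u)) ≠ 0) :
    (A + r • vecMulVec u v)⁻¹ =
      A⁻¹ - (r / (1 + r * (v ⬝ᵥ (A⁻¹ *ᵥ u)))) • vecMulVec (A⁻¹ *ᵥ u) (v ᵥ* A⁻¹) := by
  apply inv_eq_right_inv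
  have h₁ : A * vecMulVec (A⁻¹ *ᵥ u) (v ᵥ* A⁻¹) = vecMulVec u (v ᵥ* A⁻¹) := by
    rw [mul_vecMulVec, mulVec_mulVec, mul_nonsing_inv A hA, one_mulVec]
  have h₂ : vecMulVec u v * vecMulVec (A⁻¹ *ᵥ u) (v ᵥ* A⁻¹) =
      (v ⬝ᵥ (A⁻¹ *ᵥ u)) • vecMulVec u (v ᵥ* A⁻¹) := by
    rw [vecMulVec_mul_vecMulVec, vecMulVec_smul]
  have h₃ : r - r / (1 + r * (v ⬝ᵥ (A⁻¹ *ᵥ u))) -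
      r * (r / (1 + r * (v ⬝ᵥ (A⁻¹ *ᵥ u))) * (v ⬝ᵥ (A⁻¹ *ᵥ u))) = 0 := by
    field_simp
    ring
  simp only [add_mul, mul_sub, mul_nonsing_inv A hA, Matrix.mul_smul, Matrix.smul_mul, h₁, h₂,
    vecMulVec_mul]
  linear_combination (norm := module) h₃ • vecMulVec u (v ᵥ* A⁻¹)

/-- The trace of the inverse of a scaled rank-one update, multiplied by a matrix. -/
theorem trace_inv_add_smul_vecMulVec_mul {n K : Type*} [Fintype n] [DecidableEq n] [Field K]
    {A : Matrix n n K} (hA : IsUnit A.det) (S : Matrix n n K) (r : K) (u v : n → K)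
    (h : 1 + r * (v ⬝ᵥ (A⁻¹ *ᵥ u)) ≠ 0) :
    ((A + r • vecMulVec u v)⁻¹ * S).trace =
      (A⁻¹ * S).trace -
        (v ⬝ᵥ ((A⁻¹ * S * A⁻¹) *ᵥ u)) * r / (1 + r * (v ⬝ᵥ (A⁻¹ *ᵥ u))) := by
  rw [inv_add_smul_vecMulVec hA r u v h, sub_mul, trace_sub, Matrix.smul_mul, trace_smul, vecMulVec_mul,
    trace_vecMulVec, vecMul_vecMul, dotProduct_comm (A⁻¹ *ᵥ u), ← dotProduct_mulVec, mulVec_mulVec,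
    smul_eq_mul]
  ring

/-- Exact rank-one update identity for the maximum-likelihood objective
`F = log det Σ + Tr(Σ⁻¹ S)` (Appendix A of the paper): with `c = aᴴ Σ⁻¹ a` and
`b = aᴴ Σ⁻¹ S Σ⁻¹ a`, if `1 + d c > 0` then `Σ + d a aᴴ` is invertible and
`F(Σ + d a aᴴ) = F(Σ) + log(1 + d c) - b d / (1 + d c)`. -/
theorem stmt_1 (L : ℕ) (A S : Matrix (Fin L) (Fin L) ℂ)
    (hA : A.PosDef) (hS : S.PosSemidef)
    (a : Fin L → ℂ) (d : ℝ)
    (hd : 0 < 1 + d * (star a ⬝ᵥ (A⁻¹ *ᵥ a)).re) :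
    IsUnit (A + (d : ℂ) • Matrix.vecMulVec a (star a)) ∧
    Real.log ((A + (d : ℂ) • Matrix.vecMulVec a (star a)).det.re) +
        (((A + (d : ℂ) • Matrix.vecMulVec a (star a))⁻¹) * S).trace.re =
      Real.log (A.det.re) + (A⁻¹ * S).trace.re +
        Real.log (1 + d * (star a ⬝ᵥ (A⁻¹ *ᵥ a)).re) -
        (star a ⬝ᵥ ((A⁻¹ * S * A⁻¹) *ᵥ a)).re * d /
          (1 + d * (star a ⬝ᵥ (A⁻¹ *ᵥ a)).re) := by
  have hu : IsUnit A.det := (isUnit_iff_isUnit_det A).mp hA.isUnit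
  have hc : star a ⬝ᵥ (A⁻¹ *ᵥ a) = ((star a ⬝ᵥ (A⁻¹ *ᵥ a)).re : ℂ) :=
    Complex.ext rfl
      (Complex.nonneg_iff.mp (hA.inv.posSemidef.dotProduct_mulVec_nonneg a)).2.symm
  have hdet : A.det = (A.det.re : ℂ) :=
    Complex.ext rfl (Complex.pos_iff.mp hA.det_pos).2.symm
  have hdet_pos : 0 < A.det.re := (Complex.pos_iff.mp hA.det_pos).1
  have hk : 1 + (d : ℂ) * (star a ⬝ᵥ (A⁻¹ *ᵥ a)) =
      ((1 + d * (star a ⬝ᵥ (A⁻¹ *ᵥ a)).re : ℝ) : ℂ) := by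
    rw [hc]
    push_cast [Complex.ofReal_re]
    rfl
  have hk_ne : 1 + (d : ℂ) * (star a ⬝ᵥ (A⁻¹ *ᵥ a)) ≠ 0 := by
    rw [hk]
    exact_mod_cast hd.ne'
  have hdet_update := det_add_smul_vecMulVec hu (d : ℂ) a (star a)
  refine ⟨?_, ?_⟩
  · rw [isUnit_iff_isUnit_det, hdet_update]
    exact hu.mul hk_ne.isUnit
  · rw [trace_inv_add_smul_vecMulVec_mul hu S (d : ℂ) a (star a) hk_ne, hdet_update, hk,
      Complex.re_mul_ofReal, Real.log_mul hdet_pos.ne' hd.ne', Complex.sub_re,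
      Complex.div_ofReal_re, Complex.re_mul_ofReal]
    ring
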